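/- arXiv:1104.1877 — 3 statements merged into one kernel-verified Lean document; each statement's English description precedes it below -/
import Mathlib

section
/- The Manin matrix R^{(r|s)}, viewed as an operator R on V ⊗ V, satisfies the Yang–Baxter equation: (R ⊗ id_V) ∘ (id_V ⊗ R) ∘ (R ⊗ id_V) = (id_V ⊗ R) ∘ (R ⊗ id_V) ∘ (id_V ⊗ R) as operators on V ⊗ V ⊗ V. -/
open TensorProduct

/-- Parity of a basis index: `0` for `i ≤ r` (even) and `1` for `i > r` (odd);
here indices are `0`-based, so index `i` is even iff `i < r`. -/
def maninParity (r s : ℕ) (i : Fin (r + s)) : ℕ := if (i : ℕ) < r then 0 else 1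

/-- Entries of Manin's matrix `R^{(r|s)}`:
`maninEntry q r s k l i j = R^{kl}_{ij}`, equal to `q²` if `i=j=k=l` with `i` even,
`−1` if `i=j=k=l` with `i` odd, `q²−1` if `k=i<j=l`, `(−1)^{ĩ·j̃}·q` if `k=j≠i=l`,
and `0` otherwise. -/
def maninEntry {K : Type*} [Field K] (q : K) (r s : ℕ) (k l i j : Fin (r + s)) : K :=
  if i = j ∧ j = k ∧ k = l then (if maninParity r s i = 0 then q ^ 2 else -1)
  else if k = i ∧ l = j ∧ i < j then q ^ 2 - 1
  else if k = j ∧ l = i ∧ i ≠ j then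
    (-1 : K) ^ (maninParity r s i * maninParity r s j) * q
  else 0

/-- Manin's matrix viewed as the linear operator `R` on `V ⊗ V`, where `V` is the
free module with basis `x_1, …, x_d`, `d = r + s`:
`R(x_i ⊗ x_j) = Σ_{k,l} x_k ⊗ x_l R^{kl}_{ij}`. -/
noncomputable def maninOp (K : Type*) [Field K] (q : K) (r s : ℕ) :
    ((Fin (r + s) → K) ⊗[K] (Fin (r + s) → K)) →ₗ[K]
      ((Fin (r + s) → K) ⊗[K] (Fin (r + s) → K)) :=
  (((Pi.basisFun K (Fin (r + s))).tensorProduct (Pi.basisFun K (Fin (r + s)))).constr K)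
    (fun p => ∑ a : Fin (r + s), ∑ b : Fin (r + s),
      maninEntry q r s a b p.1 p.2 •
        (Pi.basisFun K (Fin (r + s)) a ⊗ₜ[K] Pi.basisFun K (Fin (r + s)) b))

/-- `R ⊗ id_V` as an operator on `V ⊗ (V ⊗ V)`, transported along the associator. -/
noncomputable def maninOp₁ (K : Type*) [Field K] (q : K) (r s : ℕ) :
    ((Fin (r + s) → K) ⊗[K] ((Fin (r + s) → K) ⊗[K] (Fin (r + s) → K))) →ₗ[K]
      ((Fin (r + s) → K) ⊗[K] ((Fin (r + s) → K) ⊗[K] (Fin (r + s) → K))) :=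
  (TensorProduct.assoc K _ _ _).toLinearMap ∘ₗ
    ((maninOp K q r s).rTensor (Fin (r + s) → K)) ∘ₗ
      (TensorProduct.assoc K _ _ _).symm.toLinearMap

/-- `id_V ⊗ R` as an operator on `V ⊗ (V ⊗ V)`. -/
noncomputable def maninOp₂ (K : Type*) [Field K] (q : K) (r s : ℕ) :
    ((Fin (r + s) → K) ⊗[K] ((Fin (r + s) → K) ⊗[K] (Fin (r + s) → K))) →ₗ[K]
      ((Fin (r + s) → K) ⊗[K] ((Fin (r + s) → K) ⊗[K] (Fin (r + s) → K))) :=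
  (maninOp K q r s).lTensor (Fin (r + s) → K)

/-- Coefficient of `x_i ⊗ x_j` in `R(x_i ⊗ x_j)` for `i ≠ j`; it is `0` for `i = j`. -/
def maninDiag {K ι : Type*} [Field K] [LinearOrder ι] (q : K) (i j : ι) : K :=
  if i < j then q ^ 2 - 1 else 0

/-- Coefficient of `x_j ⊗ x_i` in `R(x_i ⊗ x_j)`. -/
def maninSwap {K : Type*} [Field K] (q : K) (r s : ℕ) (i j : Fin (r + s)) : K :=
  if i = j then (if maninParity r s i = 0 then q ^ 2 else -1)
  else (-1 : K) ^ (maninParity r s i * maninParity r s j) * q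

lemma maninDiag_self {K ι : Type*} [Field K] [LinearOrder ι] (q : K) (i : ι) :
    maninDiag q i i = 0 :=
  if_neg (lt_irrefl i)

lemma maninDiag_trichotomy {K ι : Type*} [Field K] [LinearOrder ι] (q : K) (i j : ι) :
    i = j ∨ (i < j ∧ maninDiag q i j = q ^ 2 - 1 ∧ maninDiag q j i = 0) ∨
      (j < i ∧ maninDiag q i j = 0 ∧ maninDiag q j i = q ^ 2 - 1) := by
  unfold maninDiag
  grind

lemma maninEntry_eq {K : Type*} [Field K] (q : K) (r s : ℕ) (k l i j : Fin (r + s)) :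
    maninEntry q r s k l i j =
      (if k = i then if l = j then maninDiag q i j else 0 else 0) +
        (if k = j then if l = i then maninSwap q r s i j else 0 else 0) := by
  unfold maninEntry maninDiag maninSwap
  grind

lemma maninSwap_comm {K : Type*} [Field K] (q : K) (r s : ℕ) (i j : Fin (r + s)) :
    maninSwap q r s i j = maninSwap q r s j i := by
  unfold maninSwap
  grind

lemma maninSwap_sq {K : Type*} [Field K] (q : K) (r s : ℕ) {i j : Fin (r + s)} (h : i ≠ j) :
    maninSwap q r s i j ^ 2 = q ^ 2 := by
  rw [maninSwap, if_neg h, mul_pow, ← pow_mul, mul_comm _ 2, pow_mul]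
  simp

lemma maninSwap_self {K : Type*} [Field K] (q : K) (r s : ℕ) (i : Fin (r + s)) :
    maninSwap q r s i i ^ 2 = (q ^ 2 - 1) * maninSwap q r s i i + q ^ 2 := by
  unfold maninSwap
  rw [if_pos rfl]
  split_ifs <;> ring

lemma maninOp_tmul (K : Type*) [Field K] (q : K) (r s : ℕ) (i j : Fin (r + s)) :
    maninOp K q r s (Pi.basisFun K (Fin (r + s)) i ⊗ₜ[K] Pi.basisFun K (Fin (r + s)) j) =
      maninDiag q i j • (Pi.basisFun K (Fin (r + s)) i ⊗ₜ[K] Pi.basisFun K (Fin (r + s)) j) +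
      maninSwap q r s i j •
        (Pi.basisFun K (Fin (r + s)) j ⊗ₜ[K] Pi.basisFun K (Fin (r + s)) i) := by
  rw [maninOp, ← Module.Basis.tensorProduct_apply, Module.Basis.constr_basis]
  simp only [maninEntry_eq, add_smul, ite_smul, zero_smul, Finset.sum_add_distrib]
  simp only [Finset.sum_ite_irrel, Finset.sum_const_zero, Finset.sum_ite_eq',
    Finset.mem_univ, if_true, Module.Basis.tensorProduct_apply]

lemma maninOp₁_tmul (K : Type*) [Field K] (q : K) (r s : ℕ) (i j k : Fin (r + s)) :
    maninOp₁ K q r s (Pi.basisFun K (Fin (r + s)) i ⊗ₜ[K]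
        (Pi.basisFun K (Fin (r + s)) j ⊗ₜ[K] Pi.basisFun K (Fin (r + s)) k)) =
      maninDiag q i j • (Pi.basisFun K (Fin (r + s)) i ⊗ₜ[K]
        (Pi.basisFun K (Fin (r + s)) j ⊗ₜ[K] Pi.basisFun K (Fin (r + s)) k)) +
      maninSwap q r s i j • (Pi.basisFun K (Fin (r + s)) j ⊗ₜ[K]
        (Pi.basisFun K (Fin (r + s)) i ⊗ₜ[K] Pi.basisFun K (Fin (r + s)) k)) := by
  simp only [maninOp₁, LinearMap.comp_apply, LinearEquiv.coe_coe, TensorProduct.assoc_symm_tmul,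
    LinearMap.rTensor_tmul, maninOp_tmul, add_tmul, smul_tmul', map_add,
    TensorProduct.assoc_tmul]

lemma maninOp₂_tmul (K : Type*) [Field K] (q : K) (r s : ℕ) (i j k : Fin (r + s)) :
    maninOp₂ K q r s (Pi.basisFun K (Fin (r + s)) i ⊗ₜ[K]
        (Pi.basisFun K (Fin (r + s)) j ⊗ₜ[K] Pi.basisFun K (Fin (r + s)) k)) =
      maninDiag q j k • (Pi.basisFun K (Fin (r + s)) i ⊗ₜ[K]
        (Pi.basisFun K (Fin (r + s)) j ⊗ₜ[K] Pi.basisFun K (Fin (r + s)) k)) +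
      maninSwap q r s j k • (Pi.basisFun K (Fin (r + s)) i ⊗ₜ[K]
        (Pi.basisFun K (Fin (r + s)) k ⊗ₜ[K] Pi.basisFun K (Fin (r + s)) j)) := by
  simp only [maninOp₂, LinearMap.lTensor_tmul, maninOp_tmul, tmul_add, tmul_smul]

/-- The Manin matrix `R^{(r|s)}`, viewed as an operator on `V ⊗ V`, satisfies the
Yang–Baxter equation `(R ⊗ id) ∘ (id ⊗ R) ∘ (R ⊗ id) = (id ⊗ R) ∘ (R ⊗ id) ∘ (id ⊗ R)`
as operators on `V ⊗ V ⊗ V`. -/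
theorem manin_yang_baxter (K : Type*) [Field K] (q : K) (r s : ℕ) :
    maninOp₁ K q r s ∘ₗ maninOp₂ K q r s ∘ₗ maninOp₁ K q r s =
      maninOp₂ K q r s ∘ₗ maninOp₁ K q r s ∘ₗ maninOp₂ K q r s := by
  refine ((Pi.basisFun K (Fin (r + s))).tensorProduct
    ((Pi.basisFun K (Fin (r + s))).tensorProduct (Pi.basisFun K (Fin (r + s))))).ext ?_
  rintro ⟨i, j, k⟩
  simp only [Module.Basis.tensorProduct_apply, LinearMap.comp_apply, maninOp₁_tmul, maninOp₂_tmul,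
    map_add, map_smul]
  have hij := maninSwap_comm q r s i j
  have hjk := maninSwap_comm q r s j k
  have hik := maninSwap_comm q r s i k
  have sij := maninSwap_sq q r s (i := i) (j := j)
  have sjk := maninSwap_sq q r s (i := j) (j := k)
  have sik := maninSwap_sq q r s (i := i) (j := k)
  have ti := maninSwap_self q r s i
  have tj := maninSwap_self q r s j
  generalize Pi.basisFun K (Fin (r + s)) = e
  obtain eij | ⟨lij, dij, dji⟩ | ⟨lij, dij, dji⟩ := maninDiag_trichotomy q i j <;>
    obtain ejk | ⟨ljk, djk, dkj⟩ | ⟨ljk, djk, dkj⟩ := maninDiag_trichotomy q j k <;>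
    obtain eik | ⟨lik, dik, dki⟩ | ⟨lik, dik, dki⟩ := maninDiag_trichotomy q i k <;>
    first
    | (exfalso; order)
    | (subst_vars
       match_scalars <;> grind [maninDiag_self])
end

section
/- The Manin matrix R^{(r|s)}, viewed as an operator R on V ⊗ V, satisfies the Hecke equation (R − q²·id) ∘ (R + id) = 0 on V ⊗ V. -/
open TensorProduct

theorem maninOp_basis (K : Type*) [Field K] (q : K) (r s : ℕ) (i j : Fin (r + s)) :
    maninOp K q r s (Pi.basisFun K _ i ⊗ₜ[K] Pi.basisFun K _ j) =
      ∑ a : Fin (r + s), ∑ b : Fin (r + s), maninEntry q r s a b i j •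
        (Pi.basisFun K (Fin (r + s)) a ⊗ₜ[K] Pi.basisFun K (Fin (r + s)) b) := by
  rw [← Module.Basis.tensorProduct_apply, maninOp, Module.Basis.constr_basis]

theorem maninOp_basis_self (K : Type*) [Field K] (q : K) (r s : ℕ) (i : Fin (r + s)) :
    maninOp K q r s (Pi.basisFun K _ i ⊗ₜ[K] Pi.basisFun K _ i) =
      (if maninParity r s i = 0 then q ^ 2 else -1 : K) •
        (Pi.basisFun K (Fin (r + s)) i ⊗ₜ[K] Pi.basisFun K (Fin (r + s)) i) := by
  have entry (a b : Fin (r + s)) : maninEntry q r s a b i i =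
      if a = i then if b = i then (if maninParity r s i = 0 then q ^ 2 else -1) else 0
      else 0 := by
    unfold maninEntry
    grind
  rw [maninOp_basis]
  simp only [entry, ite_smul, zero_smul, Finset.sum_ite_irrel, Finset.sum_const_zero,
    Finset.sum_ite_eq', Finset.mem_univ, if_true]

theorem maninOp_basis_of_ne (K : Type*) [Field K] (q : K) (r s : ℕ) {i j : Fin (r + s)}
    (hij : i ≠ j) :
    maninOp K q r s (Pi.basisFun K _ i ⊗ₜ[K] Pi.basisFun K _ j) =
      (if i < j then q ^ 2 - 1 else 0 : K) •
        (Pi.basisFun K (Fin (r + s)) i ⊗ₜ[K] Pi.basisFun K (Fin (r + s)) j) +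
      ((-1) ^ (maninParity r s i * maninParity r s j) * q : K) •
        (Pi.basisFun K (Fin (r + s)) j ⊗ₜ[K] Pi.basisFun K (Fin (r + s)) i) := by
  have entry (a b : Fin (r + s)) : maninEntry q r s a b i j =
      (if a = i then if b = j then (if i < j then q ^ 2 - 1 else 0) else 0 else 0) +
      (if a = j then if b = i then (-1) ^ (maninParity r s i * maninParity r s j) * q else 0
        else 0) := by
    unfold maninEntry
    grind
  rw [maninOp_basis]
  simp only [entry, add_smul, Finset.sum_add_distrib]
  congr 1 <;>
  simp only [ite_smul, zero_smul, Finset.sum_ite_irrel, Finset.sum_const_zero,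
    Finset.sum_ite_eq', Finset.mem_univ, if_true]

/-- The Manin matrix `R^{(r|s)}`, viewed as an operator `R` on `V ⊗ V`, satisfies
the Hecke equation `(R − q²·id) ∘ (R + id) = 0` on `V ⊗ V`. -/
theorem manin_hecke (K : Type*) [Field K] (q : K) (r s : ℕ) :
    (maninOp K q r s - q ^ 2 • LinearMap.id) ∘ₗ (maninOp K q r s + LinearMap.id) = 0 := by
  refine ((Pi.basisFun K (Fin (r + s))).tensorProduct (Pi.basisFun K (Fin (r + s)))).ext ?_
  rintro ⟨i, j⟩
  simp only [Module.Basis.tensorProduct_apply, LinearMap.comp_apply, LinearMap.sub_apply,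
    LinearMap.add_apply, LinearMap.smul_apply, LinearMap.id_apply, LinearMap.zero_apply]
  rcases eq_or_ne i j with rfl | hij
  · simp only [maninOp_basis_self, map_add, map_smul]
    split_ifs <;> module
  · have sign_sq : ((-1 : K) ^ (maninParity r s i * maninParity r s j)) ^ 2 = 1 := by
      rw [← pow_mul, mul_comm, pow_mul, neg_one_sq, one_pow]
    simp only [maninOp_basis_of_ne K q r s hij, maninOp_basis_of_ne K q r s hij.symm, map_add,
      map_smul, mul_comm (maninParity r s j)]
    generalize (-1 : K) ^ (maninParity r s i * maninParity r s j) = σ at sign_sq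
    rcases hij.lt_or_gt with h | h <;>
    · simp only [h, h.not_gt, if_true, if_false]
      match_scalars <;> first | ring1 | linear_combination q ^ 2 * sign_sq
end

section
/- Assume q ≠ 0 and q is not a root of unity of order larger than 1 (i.e. q^d ≠ 1 for every integer d ≥ 2). Then the Manin matrix R^{(r|s)} satisfies the closure condition: there exists a matrix P with entries P^{im}_{jn} (1 ≤ i,j,m,n ≤ d) such that for all 1 ≤ i,j,k,l ≤ d one has Σ_{m,n} P^{im}_{jn} R^{nk}_{ml} = δ^i_l δ^k_j. -/
/-- Manin's matrix as a square matrix with rows `(m, n)` and columns `(k, l)`, both in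
lexicographic order, whose entries are `R^{nk}_{ml}`. -/
def maninMatrix {K : Type*} [Field K] (q : K) (r s : ℕ) :
    Matrix (Fin (r + s) ×ₗ Fin (r + s)) (Fin (r + s) ×ₗ Fin (r + s)) K :=
  fun x y => maninEntry q r s (ofLex x).2 (ofLex y).1 (ofLex x).1 (ofLex y).2

theorem maninMatrix_blockTriangular {K : Type*} [Field K] (q : K) (r s : ℕ) :
    (maninMatrix q r s).BlockTriangular id := by
  intro x y hxy
  obtain ⟨m, n⟩ := x
  obtain ⟨k, l⟩ := y
  have h : k < m ∨ k = m ∧ l < n := Prod.Lex.lt_iff.1 hxy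
  change maninEntry q r s n k m l = 0
  unfold maninEntry
  split_ifs <;> first | rfl | (exfalso; omega)

theorem maninMatrix_diag_ne_zero {K : Type*} [Field K] {q : K} (hq0 : q ≠ 0) (r s : ℕ)
    (x : Fin (r + s) ×ₗ Fin (r + s)) : maninMatrix q r s x x ≠ 0 := by
  obtain ⟨m, n⟩ := x
  change maninEntry q r s n m m n ≠ 0
  unfold maninEntry
  split_ifs <;> first | (exfalso; omega) | simp [hq0]

theorem isUnit_det_maninMatrix {K : Type*} [Field K] {q : K} (hq0 : q ≠ 0) (r s : ℕ) :
    IsUnit (maninMatrix q r s).det := by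
  rw [Matrix.det_of_isUpperTriangular (maninMatrix_blockTriangular q r s), isUnit_iff_ne_zero]
  exact Finset.prod_ne_zero_iff.2 fun x _ => maninMatrix_diag_ne_zero hq0 r s x

/-- If `q ≠ 0` and `q` is not a root of unity of order larger than 1, then the
Manin matrix `R^{(r|s)}` satisfies the closure condition: there exists a matrix
`P` with entries `P^{im}_{jn}` such that `Σ_{m,n} P^{im}_{jn} R^{nk}_{ml} = δ^i_l δ^k_j`
for all `i, j, k, l`.  Here `P i m j n` stands for `P^{im}_{jn}` (upper indices
first) and `maninEntry q r s n k m l` stands for `R^{nk}_{ml}`. -/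
theorem manin_closure (K : Type*) [Field K] (q : K) (r s : ℕ)
    (hq0 : q ≠ 0) (hq : ∀ d : ℕ, 2 ≤ d → q ^ d ≠ 1) :
    ∃ P : Fin (r + s) → Fin (r + s) → Fin (r + s) → Fin (r + s) → K,
      ∀ i j k l : Fin (r + s),
        (∑ m : Fin (r + s), ∑ n : Fin (r + s), P i m j n * maninEntry q r s n k m l) =
          (if i = l then (1 : K) else 0) * (if k = j then (1 : K) else 0) := by
  refine ⟨fun i m j n => (maninMatrix q r s)⁻¹ (toLex (j, i)) (toLex (m, n)), fun i j k l => ?_⟩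
  have h := congrFun (congrFun
    (Matrix.nonsing_inv_mul _ (isUnit_det_maninMatrix hq0 r s)) (toLex (j, i))) (toLex (k, l))
  rw [Matrix.mul_apply, ← toLex.sum_comp, Fintype.sum_prod_type, Matrix.one_apply] at h
  refine Eq.trans h ?_
  simp only [EmbeddingLike.apply_eq_iff_eq, Prod.mk.injEq, eq_comm (a := k)]
  by_cases h1 : i = l <;> by_cases h2 : j = k <;> simp [h1, h2]
end
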